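/- arXiv:1012.4561 — 5 statements merged into one kernel-verified Lean document; each statement's English description precedes it below -/
import Mathlib

section
/- The two extreme characteristic fields are genuinely nonlinear: at every point w = (ρ, m, 𝓔, q) of Ω and for each sign s ∈ {+1, −1}, every nonzero vector r ∈ ℝ⁴ satisfying Df(w) r = (u + s c) r also satisfies ∇λ_s(w) · r ≠ 0, where λ_s(ρ, m, 𝓔, q) = m/ρ + s c(ρ, m, 𝓔, q), u = m/ρ and c = √(γ(Y) p / ρ). -/
/-- Mixture adiabatic exponent γ(Y). -/
noncomputable def gam (Cp1 Cp2 Cv1 Cv2 Y : ℝ) : ℝ :=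
  (Y * Cp1 + (1 - Y) * Cp2) / (Y * Cv1 + (1 - Y) * Cv2)

/-- Mixture pressure p = (γ(Y) − 1)(𝓔 − m²/(2ρ)) in the conservative
variables w = (ρ, m, 𝓔, q), Y = q/ρ. -/
noncomputable def pres (Cp1 Cp2 Cv1 Cv2 : ℝ) (w : Fin 4 → ℝ) : ℝ :=
  (gam Cp1 Cp2 Cv1 Cv2 (w 3 / w 0) - 1) * (w 2 - (w 1) ^ 2 / (2 * w 0))

/-- Mixture Euler flux f(ρ, m, 𝓔, q) = (m, m²/ρ + p, (𝓔 + p) m/ρ, q m/ρ). -/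
noncomputable def flux (Cp1 Cp2 Cv1 Cv2 : ℝ) (w : Fin 4 → ℝ) : Fin 4 → ℝ :=
  ![w 1,
    (w 1) ^ 2 / w 0 + pres Cp1 Cp2 Cv1 Cv2 w,
    (w 2 + pres Cp1 Cp2 Cv1 Cv2 w) * (w 1 / w 0),
    w 3 * (w 1 / w 0)]

/-- The phase space Ω = {ρ > 0, 0 < q/ρ < 1, 𝓔 − m²/(2ρ) > 0}. -/
def Omega : Set (Fin 4 → ℝ) :=
  {w | 0 < w 0 ∧ 0 < w 3 / w 0 ∧ w 3 / w 0 < 1 ∧ 0 < w 2 - (w 1) ^ 2 / (2 * w 0)}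

/-- Sound speed c = √(γ(Y) p / ρ). -/
noncomputable def soundSpeed (Cp1 Cp2 Cv1 Cv2 : ℝ) (w : Fin 4 → ℝ) : ℝ :=
  Real.sqrt (gam Cp1 Cp2 Cv1 Cv2 (w 3 / w 0) * pres Cp1 Cp2 Cv1 Cv2 w / w 0)

/-- Jacobian matrix (Df(w))_{ij} = ∂f_i/∂w_j. -/
noncomputable def jacobian (Cp1 Cp2 Cv1 Cv2 : ℝ) (w : Fin 4 → ℝ) :
    Matrix (Fin 4) (Fin 4) ℝ :=
  Matrix.of fun i j => fderiv ℝ (flux Cp1 Cp2 Cv1 Cv2) w (Pi.single j 1) i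

theorem mixture_pos {a b Y : ℝ} (ha : 0 < a) (hb : 0 < b) (h0 : 0 < Y) (h1 : Y < 1) :
    0 < Y * a + (1 - Y) * b := by
  have := sub_pos.mpr h1
  positivity

theorem one_lt_gam {Cp1 Cp2 Cv1 Cv2 Y : ℝ} (hCv1 : 0 < Cv1) (hCp1 : Cv1 < Cp1)
    (hCv2 : 0 < Cv2) (hCp2 : Cv2 < Cp2) (h0 : 0 < Y) (h1 : Y < 1) :
    1 < gam Cp1 Cp2 Cv1 Cv2 Y := by
  rw [gam, one_lt_div (mixture_pos hCv1 hCv2 h0 h1)]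
  linarith [mixture_pos (sub_pos.mpr hCp1) (sub_pos.mpr hCp2) h0 h1]

theorem differentiableAt_gam {Cp1 Cp2 Cv1 Cv2 Y : ℝ} (h : Y * Cv1 + (1 - Y) * Cv2 ≠ 0) :
    DifferentiableAt ℝ (gam Cp1 Cp2 Cv1 Cv2) Y := by
  unfold gam
  fun_prop (disch := exact h)

theorem hasFDerivAt_coord (w : Fin 4 → ℝ) (i : Fin 4) :
    HasFDerivAt (fun v : Fin 4 → ℝ => v i)
      (ContinuousLinearMap.proj i : (Fin 4 → ℝ) →L[ℝ] ℝ) w :=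
  (ContinuousLinearMap.proj i : (Fin 4 → ℝ) →L[ℝ] ℝ).hasFDerivAt

theorem exists_hasFDerivAt_div_density {f : (Fin 4 → ℝ) → ℝ} {f' : (Fin 4 → ℝ) →L[ℝ] ℝ}
    {w : Fin 4 → ℝ} (hf : HasFDerivAt f f' w) (h : w 0 ≠ 0) :
    ∃ L : (Fin 4 → ℝ) →L[ℝ] ℝ, HasFDerivAt (fun v : Fin 4 → ℝ => f v / v 0) L w ∧
      ∀ r, L r = (f' r - f w / w 0 * r 0) / w 0 := by
  have hinv := HasDerivAt.comp_hasFDerivAt w (hasDerivAt_inv h) (hasFDerivAt_coord w 0)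
  refine ⟨_, hf.fun_mul hinv, fun r => ?_⟩
  simp
  field_simp
  ring

theorem differentiableAt_pres {Cp1 Cp2 Cv1 Cv2 : ℝ} {w : Fin 4 → ℝ} (h : w 0 ≠ 0)
    (hg : DifferentiableAt ℝ (gam Cp1 Cp2 Cv1 Cv2) (w 3 / w 0)) :
    DifferentiableAt ℝ (pres Cp1 Cp2 Cv1 Cv2) w := by
  have hY : DifferentiableAt ℝ (fun v : Fin 4 → ℝ => v 3 / v 0) w := by
    fun_prop (disch := exact h)
  have hG : DifferentiableAt ℝ (fun v : Fin 4 → ℝ => gam Cp1 Cp2 Cv1 Cv2 (v 3 / v 0)) w :=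
    DifferentiableAt.comp (g := gam Cp1 Cp2 Cv1 Cv2) w hg hY
  have h2 : 2 * w 0 ≠ 0 := mul_ne_zero two_ne_zero h
  unfold pres
  fun_prop (disch := exact h2)

theorem fderiv_flux_apply {Cp1 Cp2 Cv1 Cv2 : ℝ} {w : Fin 4 → ℝ} (h : w 0 ≠ 0)
    (hp : DifferentiableAt ℝ (pres Cp1 Cp2 Cv1 Cv2) w) (r : Fin 4 → ℝ) :
    fderiv ℝ (flux Cp1 Cp2 Cv1 Cv2) w r =
      ![r 1,
        2 * (w 1 / w 0) * r 1 - (w 1 / w 0) ^ 2 * r 0 + fderiv ℝ (pres Cp1 Cp2 Cv1 Cv2) w r,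
        (r 2 + fderiv ℝ (pres Cp1 Cp2 Cv1 Cv2) w r) * (w 1 / w 0) +
          (w 2 + pres Cp1 Cp2 Cv1 Cv2 w) * ((r 1 - w 1 / w 0 * r 0) / w 0),
        r 3 * (w 1 / w 0) + w 3 * ((r 1 - w 1 / w 0 * r 0) / w 0)] := by
  obtain ⟨U, hU, hUr⟩ := exists_hasFDerivAt_div_density (hasFDerivAt_coord w 1) h
  have h0 := hasFDerivAt_coord w 1
  obtain ⟨K, hK, hKr⟩ := exists_hasFDerivAt_div_density (h0.pow 2) h
  have h1 := hK.fun_add hp.hasFDerivAt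
  have h2 := ((hasFDerivAt_coord w 2).fun_add hp.hasFDerivAt).fun_mul hU
  have h3 := (hasFDerivAt_coord w 3).fun_mul hU
  have d : DifferentiableAt ℝ (flux Cp1 Cp2 Cv1 Cv2) w := by
    rw [differentiableAt_pi]
    intro i
    fin_cases i
    exacts [h0.differentiableAt, h1.differentiableAt, h2.differentiableAt, h3.differentiableAt]
  have key (i : Fin 4) : fderiv ℝ (flux Cp1 Cp2 Cv1 Cv2) w r i =
      fderiv ℝ (fun v => flux Cp1 Cp2 Cv1 Cv2 v i) w r := by
    rw [fderiv_apply d]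
    rfl
  ext i
  rw [key]
  fin_cases i
  · exact congrArg (· r) h0.fderiv
  · refine (congrArg (· r) h1.fderiv).trans ?_
    simp [hKr]
    field_simp
  · refine (congrArg (· r) h2.fderiv).trans ?_
    simp [hUr]
    ring
  · refine (congrArg (· r) h3.fderiv).trans ?_
    simp [hUr]
    ring

/-- Along directions that leave the mass fraction `Y` unchanged, the exponent `γ(Y)` does not
contribute to the derivative of the wave speed `u + s c`. -/
theorem fderiv_wave_speed_apply {Cp1 Cp2 Cv1 Cv2 : ℝ} {w : Fin 4 → ℝ} (h : w 0 ≠ 0)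
    (hg : DifferentiableAt ℝ (gam Cp1 Cp2 Cv1 Cv2) (w 3 / w 0))
    (hc : gam Cp1 Cp2 Cv1 Cv2 (w 3 / w 0) * pres Cp1 Cp2 Cv1 Cv2 w / w 0 ≠ 0)
    (s : ℝ) {r : Fin 4 → ℝ} (hr : r 3 = w 3 / w 0 * r 0) :
    fderiv ℝ (fun v : Fin 4 → ℝ => v 1 / v 0 + s * soundSpeed Cp1 Cp2 Cv1 Cv2 v) w r =
      (r 1 - w 1 / w 0 * r 0) / w 0 +
        s * (gam Cp1 Cp2 Cv1 Cv2 (w 3 / w 0) *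
          (fderiv ℝ (pres Cp1 Cp2 Cv1 Cv2) w r - pres Cp1 Cp2 Cv1 Cv2 w / w 0 * r 0) / w 0 /
            (2 * soundSpeed Cp1 Cp2 Cv1 Cv2 w)) := by
  obtain ⟨U, hU, hUr⟩ := exists_hasFDerivAt_div_density (hasFDerivAt_coord w 1) h
  obtain ⟨Y, hY, hYr⟩ := exists_hasFDerivAt_div_density (hasFDerivAt_coord w 3) h
  have hG := HasDerivAt.comp_hasFDerivAt w hg.hasDerivAt hY
  have hP := (differentiableAt_pres h hg).hasFDerivAt
  obtain ⟨Q, hQ, hQr⟩ := exists_hasFDerivAt_div_density (hG.fun_mul hP) h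
  have hS := hQ.sqrt hc
  refine (congrArg (· r) (hU.fun_add (hS.const_mul s)).fderiv).trans ?_
  have hY0 : Y r = 0 := by simp [hYr, hr]
  simp [hUr, hQr, hY0, soundSpeed, -mul_eq_mul_left_iff]
  ring

/-- the two extreme fields are genuinely nonlinear: at every
w ∈ Ω and for each sign s ∈ {+1, −1}, every nonzero r with
Df(w) r = (u + s c) r satisfies ∇λ_s(w) · r ≠ 0, where
λ_s(ρ, m, 𝓔, q) = m/ρ + s c(ρ, m, 𝓔, q). -/
theorem extreme_fields_genuinely_nonlinear
    (Cp1 Cp2 Cv1 Cv2 : ℝ)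
    (hCv1 : 0 < Cv1) (hCp1 : Cv1 < Cp1)
    (hCv2 : 0 < Cv2) (hCp2 : Cv2 < Cp2)
    (w : Fin 4 → ℝ) (hw : w ∈ Omega) :
    ∀ s : ℝ, (s = 1 ∨ s = -1) →
    ∀ r : Fin 4 → ℝ, r ≠ 0 →
      (fderiv ℝ (flux Cp1 Cp2 Cv1 Cv2) w) r
        = (w 1 / w 0 + s * soundSpeed Cp1 Cp2 Cv1 Cv2 w) • r →
      fderiv ℝ
        (fun v : Fin 4 → ℝ => v 1 / v 0 + s * soundSpeed Cp1 Cp2 Cv1 Cv2 v)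
        w r ≠ 0 := by
  obtain ⟨hρ, hY0, hY1, hI⟩ := hw
  intro s hs r hr0 hr
  have hρ' := hρ.ne'
  have hg := differentiableAt_gam (Cp1 := Cp1) (Cp2 := Cp2) (mixture_pos hCv1 hCv2 hY0 hY1).ne'
  have hG1 := one_lt_gam hCv1 hCp1 hCv2 hCp2 hY0 hY1
  have hp : 0 < pres Cp1 Cp2 Cv1 Cv2 w := mul_pos (sub_pos.mpr hG1) hI
  have hG : 0 < gam Cp1 Cp2 Cv1 Cv2 (w 3 / w 0) := one_pos.trans hG1
  have hc2 : 0 < gam Cp1 Cp2 Cv1 Cv2 (w 3 / w 0) * pres Cp1 Cp2 Cv1 Cv2 w / w 0 := by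
    positivity
  have hc : 0 < soundSpeed Cp1 Cp2 Cv1 Cv2 w := Real.sqrt_pos.mpr hc2
  have hsq : soundSpeed Cp1 Cp2 Cv1 Cv2 w ^ 2 =
      gam Cp1 Cp2 Cv1 Cv2 (w 3 / w 0) * pres Cp1 Cp2 Cv1 Cv2 w / w 0 := Real.sq_sqrt hc2.le
  have hs0 : s ≠ 0 := by rcases hs with rfl | rfl <;> norm_num
  have hs2 : s ^ 2 = 1 := by rcases hs with rfl | rfl <;> norm_num
  rw [fderiv_flux_apply hρ' (differentiableAt_pres hρ' hg)] at hr
  have e0 := congrFun hr 0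
  have e1 := congrFun hr 1
  have e2 := congrFun hr 2
  have e3 := congrFun hr 3
  simp only [Matrix.cons_val, Pi.smul_apply, smul_eq_mul] at e0 e1 e2 e3
  have hsc : s * soundSpeed Cp1 Cp2 Cv1 Cv2 w ≠ 0 := mul_ne_zero hs0 hc.ne'
  have hr3 : r 3 = w 3 / w 0 * r 0 := by
    apply mul_left_cancel₀ hsc
    rw [e0] at e3
    linear_combination -e3
  rw [fderiv_wave_speed_apply hρ' hg hc2.ne' s hr3]
  generalize fderiv ℝ (pres Cp1 Cp2 Cv1 Cv2) w r = dp at *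
  generalize soundSpeed Cp1 Cp2 Cv1 Cv2 w = c at *
  generalize pres Cp1 Cp2 Cv1 Cv2 w = p at *
  generalize gam Cp1 Cp2 Cv1 Cv2 (w 3 / w 0) = G at *
  have hdp : dp = c ^ 2 * r 0 := by
    rw [e0] at e1
    linear_combination e1 + c ^ 2 * r 0 * hs2
  have ha : r 0 ≠ 0 := by
    intro ha
    have h1 : r 1 = 0 := by rw [e0, ha, mul_zero]
    have h2 : r 2 = 0 := by
      apply mul_left_cancel₀ hsc
      rw [hdp, h1, ha] at e2
      linear_combination -e2
    have h3 : r 3 = 0 := by rw [hr3, ha, mul_zero]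
    apply hr0
    ext i
    fin_cases i <;> assumption
  have hspeed : (r 1 - w 1 / w 0 * r 0) / w 0 + s * (G * (dp - p / w 0 * r 0) / w 0 / (2 * c)) =
      s * c * r 0 * (G + 1) / (2 * w 0) := by
    have hd : G * (dp - p / w 0 * r 0) = c ^ 2 * (G - 1) * r 0 := by
      rw [hdp]
      linear_combination r 0 * hsq
    rw [hd, e0]
    field_simp
    ring
  rw [hspeed]
  have : G + 1 ≠ 0 := by positivity
  positivity
end

section
/- The cell average of a piecewise constant function on the Lagrangian grid equals the upwind flux form: let Δx > 0, Δt > 0, x_{j+1/2} = j Δx, let (u_{j+1/2})_{j∈ℤ} be real numbers with |u_{j+1/2}| Δt ≤ Δx/2, set x*_{j+1/2} = x_{j+1/2} + u_{j+1/2} Δt and Δx*_j = x*_{j+1/2} − x*_{j−1/2}, and let φ : ℝ → ℝ equal the constant φ_j on each interval (x*_{j−1/2}, x*_{j+1/2}). Then for every j, (1/Δx) ∫_{x_{j−1/2}}^{x_{j+1/2}} φ(x) dx = (1/Δx) { Δx*_j φ_j − Δt ( u_{j+1/2} φ_{j+1/2+ε(j)} − u_{j−1/2} φ_{j−1/2+ε(j−1)}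 ) }, where ε(j) = −1/2 if u_{j+1/2} > 0 and ε(j) = +1/2 if u_{j+1/2} < 0 (and either value if u_{j+1/2} = 0, the corresponding term vanishing). -/
open MeasureTheory

/-- A function that is constant on the open interval between `a` and `b` is integrable there, and
its oriented integral is the oriented length times the constant. -/
theorem intervalIntegrable_and_integral_of_eqOn_uIoo {f : ℝ → ℝ} {a b c : ℝ}
    (h : ∀ x ∈ Set.Ioo (min a b) (max a b), f x = c) :
    IntervalIntegrable f volume a b ∧ ∫ x in a..b, f x = (b - a) * c := by
  have hae : ∀ᵐ x, x ∈ Set.uIoc a b → f x = c := by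
    filter_upwards [Measure.ae_ne volume (max a b)] with x hne hx
    exact h x ⟨hx.1, lt_of_le_of_ne hx.2 hne⟩
  constructor
  · refine (intervalIntegrable_const (c := c)).congr_ae ?_
    rw [Filter.EventuallyEq, ae_restrict_iff' measurableSet_uIoc]
    filter_upwards [hae] with x hx hmem using (hx hmem).symm
  · rw [intervalIntegral.integral_congr_ae hae, intervalIntegral.integral_const, smul_eq_mul]

/-- the cell average of a piecewise constant function on the
Lagrangian grid equals the upwind flux form.  The interface x_{j+1/2} = jΔx is
indexed by j, `xstar j` is the moved interface x*_{j+1/2}, `c j` is the value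
φ_j on the Lagrangian cell (x*_{j−1/2}, x*_{j+1/2}), and `upw j` is the upwind
value φ_{j+1/2+ε(j)} (equal to φ_j if u_{j+1/2} > 0, to φ_{j+1} if
u_{j+1/2} < 0, and to either of them if u_{j+1/2} = 0). -/
theorem projection_average_eq_upwind_flux_form
    (Δx Δt : ℝ) (hΔx : 0 < Δx) (hΔt : 0 < Δt)
    (u : ℤ → ℝ) (hcfl : ∀ j, |u j| * Δt ≤ Δx / 2)
    (xstar : ℤ → ℝ) (hxstar : ∀ j, xstar j = (j : ℝ) * Δx + u j * Δt)
    (c : ℤ → ℝ) (φ : ℝ → ℝ)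
    (hφ : ∀ j : ℤ, ∀ x ∈ Set.Ioo (xstar (j - 1)) (xstar j), φ x = c j)
    (upw : ℤ → ℝ)
    (hupw : ∀ j, (0 < u j → upw j = c j) ∧ (u j < 0 → upw j = c (j + 1)) ∧
      (u j = 0 → upw j = c j ∨ upw j = c (j + 1))) :
    ∀ j : ℤ,
      (1 / Δx) * ∫ x in (((j : ℝ) - 1) * Δx)..((j : ℝ) * Δx), φ x =
        (1 / Δx) * ((xstar j - xstar (j - 1)) * c j -
          Δt * (u j * upw j - u (j - 1) * upw (j - 1))) := by
  have key : ∀ k : ℤ, IntervalIntegrable φ volume (k * Δx) (xstar k) ∧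
      ∫ x in (k * Δx)..(xstar k), φ x = Δt * (u k * upw k) := by
    intro k
    have hk := hxstar k
    have hprev := hxstar (k - 1)
    have hnext := hxstar (k + 1)
    push_cast at hprev hnext
    have hu : ∀ i, -(Δx / 2) ≤ u i * Δt ∧ u i * Δt ≤ Δx / 2 := fun i => by
      rw [← abs_le, abs_mul, abs_of_pos hΔt]
      exact hcfl i
    have hconst : ∀ x ∈ Set.Ioo (min (k * Δx) (xstar k)) (max (k * Δx) (xstar k)),
        φ x = upw k := by
      rintro x ⟨hx₁, hx₂⟩
      rcases lt_trichotomy (u k) 0 with hneg | hzero | hpos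
      · have hlt : u k * Δt < 0 := mul_neg_of_neg_of_pos hneg hΔt
        rw [min_eq_right (by linarith)] at hx₁
        rw [max_eq_left (by linarith)] at hx₂
        rw [(hupw k).2.1 hneg]
        refine hφ (k + 1) x ⟨by simpa using hx₁, ?_⟩
        linarith [(hu (k + 1)).1]
      · have heq : xstar k = k * Δx := by rw [hk, hzero]; ring
        rw [heq, min_self] at hx₁
        rw [heq, max_self] at hx₂
        exact absurd hx₂ hx₁.not_gt
      · have hgt : 0 < u k * Δt := mul_pos hpos hΔt
        rw [min_eq_left (by linarith)] at hx₁
        rw [max_eq_right (by linarith)] at hx₂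
        rw [(hupw k).1 hpos]
        refine hφ k x ⟨?_, hx₂⟩
        linarith [(hu (k - 1)).2]
    obtain ⟨hint, hval⟩ := intervalIntegrable_and_integral_of_eqOn_uIoo hconst
    refine ⟨hint, ?_⟩
    rw [hval, hk]
    ring
  intro j
  have hle : xstar (j - 1) ≤ xstar j := by
    have h₁ := hcfl j
    have h₂ := hcfl (j - 1)
    have h₃ := mul_le_mul_of_nonneg_right (neg_abs_le (u j)) hΔt.le
    have h₄ := mul_le_mul_of_nonneg_right (le_abs_self (u (j - 1))) hΔt.le
    rw [hxstar j, hxstar (j - 1)]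
    push_cast
    linarith
  obtain ⟨hcell, hcell_val⟩ := intervalIntegrable_and_integral_of_eqOn_uIoo
    (a := xstar (j - 1)) (b := xstar j) (c := c j) (f := φ)
    (by rw [min_eq_left hle, max_eq_right hle]; exact hφ j)
  obtain ⟨hleft, hleft_val⟩ := key (j - 1)
  obtain ⟨hright, hright_val⟩ := key j
  push_cast at hleft hleft_val
  rw [← intervalIntegral.integral_add_adjacent_intervals (hleft.trans hcell) hright.symm,
    ← intervalIntegral.integral_add_adjacent_intervals hleft hcell,
    intervalIntegral.integral_symm (j * Δx) (xstar j), hleft_val, hcell_val, hright_val]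
  ring
end

section
/- For the isolated material front with Y⁰_j = 1 for j ≤ 0 and Y⁰_j = 0 for j ≥ 1, uniform ρ⁰ > 0, u⁰ > 0, p⁰ > 0 and 0 < λ u⁰ ≤ 1/2, one full Lagrange step plus conservative projection gives in the cell j = 1: Y¹_1 = u⁰ λ and (ρE)¹_1 = (ρE)⁰_1 − u⁰ λ ((ρE)⁰_1 − (ρE)⁰_0), where (ρE)⁰_j = p⁰/(γ(Y⁰_j) − 1) + ρ⁰ (u⁰)²/2. -/
open MeasureTheory

theorem intervalIntegral_eq_of_eqOn_Ioo_const {f : ℝ → ℝ} {a b c l r : ℝ} (hab : a ≤ b)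
    (hbc : b ≤ c) (hl : Set.EqOn f (fun _ => l) (Set.Ioo a b))
    (hr : Set.EqOn f (fun _ => r) (Set.Ioo b c)) :
    ∫ x in a..c, f x = (b - a) * l + (c - b) * r := by
  have il : IntervalIntegrable f volume a b :=
    (intervalIntegrable_const (c := l)).congr_uIoo (Set.uIoo_of_le hab ▸ hl.symm)
  have ir : IntervalIntegrable f volume b c :=
    (intervalIntegrable_const (c := r)).congr_uIoo (Set.uIoo_of_le hbc ▸ hr.symm)
  rw [← intervalIntegral.integral_add_adjacent_intervals il ir,
    intervalIntegral.integral_congr_Ioo_of_le hab hl,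
    intervalIntegral.integral_congr_Ioo_of_le hbc hr]
  simp

/-- for the isolated material front with Y⁰_j = 1 for j ≤ 0 and
Y⁰_j = 0 for j ≥ 1, uniform ρ⁰ > 0, u⁰ > 0, p⁰ > 0 and 0 < λu⁰ ≤ 1/2, one full
Lagrange step plus conservative projection gives in the cell j = 1
(the cell [x_{1/2}, x_{3/2}) = [0, Δx)):
Y¹₁ = u⁰λ and (ρE)¹₁ = (ρE)⁰₁ − u⁰λ((ρE)⁰₁ − (ρE)⁰₀), where
(ρE)⁰_j = p⁰/(γ(Y⁰_j) − 1) + ρ⁰(u⁰)²/2.  Here `ρfun`, `ρYfun`, `ρEfun` are the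
piecewise constant Lagrangian outputs ρ^{1−}, (ρY)^{1−}, (ρE)^{1−} on the
moved grid x*_{j+1/2} = x_{j+1/2} + u⁰Δt. -/
theorem conservative_projection_cell_one_values
    (Cp1 Cp2 Cv1 Cv2 : ℝ)
    (hCv1 : 0 < Cv1) (hCp1 : Cv1 < Cp1)
    (hCv2 : 0 < Cv2) (hCp2 : Cv2 < Cp2)
    (Δx Δt lam ρ0 u0 p0 : ℝ)
    (hΔx : 0 < Δx) (hΔt : 0 < Δt) (hlam : lam = Δt / Δx)
    (hρ0 : 0 < ρ0) (hu0 : 0 < u0) (hp0 : 0 < p0)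
    (hcfl1 : 0 < lam * u0) (hcfl2 : lam * u0 ≤ 1 / 2)
    (Y0 : ℤ → ℝ) (hY0L : ∀ j ≤ 0, Y0 j = 1) (hY0R : ∀ j ≥ 1, Y0 j = 0)
    (xstar : ℤ → ℝ) (hxstar : ∀ j, xstar j = (j : ℝ) * Δx + u0 * Δt)
    (ρfun ρYfun ρEfun : ℝ → ℝ)
    (hρfun : ∀ j : ℤ, ∀ x ∈ Set.Ioo (xstar (j - 1)) (xstar j), ρfun x = ρ0)
    (hρYfun : ∀ j : ℤ, ∀ x ∈ Set.Ioo (xstar (j - 1)) (xstar j),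
      ρYfun x = ρ0 * Y0 j)
    (hρEfun : ∀ j : ℤ, ∀ x ∈ Set.Ioo (xstar (j - 1)) (xstar j),
      ρEfun x = p0 / (gam Cp1 Cp2 Cv1 Cv2 (Y0 j) - 1) + ρ0 * u0 ^ 2 / 2) :
    ((1 / Δx) * ∫ x in (0 : ℝ)..Δx, ρYfun x) /
        ((1 / Δx) * ∫ x in (0 : ℝ)..Δx, ρfun x) = u0 * lam ∧
    (1 / Δx) * (∫ x in (0 : ℝ)..Δx, ρEfun x) =
      (p0 / (gam Cp1 Cp2 Cv1 Cv2 (Y0 1) - 1) + ρ0 * u0 ^ 2 / 2) -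
        u0 * lam *
          ((p0 / (gam Cp1 Cp2 Cv1 Cv2 (Y0 1) - 1) + ρ0 * u0 ^ 2 / 2) -
           (p0 / (gam Cp1 Cp2 Cv1 Cv2 (Y0 0) - 1) + ρ0 * u0 ^ 2 / 2)) := by
  have hΔ : u0 * Δt = u0 * lam * Δx := by rw [hlam]; field_simp
  have hshift : 0 ≤ u0 * Δt := by positivity
  have hle : u0 * Δt ≤ Δx := by rw [hΔ]; nlinarith
  have key : ∀ (f : ℝ → ℝ) (v : ℤ → ℝ),
      (∀ j : ℤ, ∀ x ∈ Set.Ioo (xstar (j - 1)) (xstar j), f x = v j) →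
      (1 / Δx) * ∫ x in (0 : ℝ)..Δx, f x = v 1 - u0 * lam * (v 1 - v 0) := by
    intro f v hf
    rw [intervalIntegral_eq_of_eqOn_Ioo_const (l := v 0) (r := v 1) hshift hle
      (fun x hx => hf 0 x ?_) (fun x hx => hf 1 x ?_), hΔ]
    · field_simp
      ring
    all_goals
      obtain ⟨h₁, h₂⟩ := hx
      simp only [hxstar, Set.mem_Ioo]
      push_cast
      constructor <;> linarith
  refine ⟨?_, key ρEfun _ hρEfun⟩
  rw [key ρYfun _ hρYfun, key ρfun (fun _ => ρ0) hρfun, hY0L 0 le_rfl, hY0R 1 le_rfl]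
  field_simp
  ring
end

section
/- For the isolated material front with Y⁰_j = 1 for j ≤ 0 and Y⁰_j = 0 for j ≥ 1, uniform ρ⁰ > 0, u⁰ > 0, p⁰ > 0 and 0 < λ u⁰ ≤ 1/2, the pressure in cell j = 1 after one full Lagrange step plus conservative projection satisfies p¹_1 = p⁰ (γ(Y¹_1) − 1) ( (1 − u⁰λ)/(γ₂ − 1) + u⁰λ/(γ₁ − 1) ), where Y¹_1 = u⁰λ and p¹_1 = (γ(Y¹_1) − 1)( (ρE)¹_1 − ρ⁰ (u⁰)²/2 ). -/
open MeasureTheory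

theorem integral_eq_of_eqOn_Ioo_const {f : ℝ → ℝ} {a b c : ℝ} (hab : a ≤ b)
    (hf : ∀ x ∈ Set.Ioo a b, f x = c) :
    IntervalIntegrable f volume a b ∧ ∫ x in a..b, f x = (b - a) * c := by
  have hae : ∀ᵐ x ∂volume.restrict (Set.Ioc a b), c = f x := by
    rw [← restrict_Ioo_eq_restrict_Ioc]
    exact (ae_restrict_mem measurableSet_Ioo).mono fun x hx => (hf x hx).symm
  constructor
  · refine (intervalIntegrable_const (c := c)).congr_ae ?_
    rwa [Set.uIoc_of_le hab]
  · rw [intervalIntegral.integral_of_le hab, ← integral_congr_ae hae,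
      ← intervalIntegral.integral_of_le hab, intervalIntegral.integral_const, smul_eq_mul]

/-- The integral of a function with a single jump at `s`. -/
theorem integral_eq_of_eqOn_Ioo_two_consts {f : ℝ → ℝ} {a s b c d : ℝ} (has : a ≤ s)
    (hsb : s ≤ b) (hc : ∀ x ∈ Set.Ioo a s, f x = c) (hd : ∀ x ∈ Set.Ioo s b, f x = d) :
    ∫ x in a..b, f x = (s - a) * c + (b - s) * d := by
  obtain ⟨hi, hI⟩ := integral_eq_of_eqOn_Ioo_const has hc
  obtain ⟨hj, hJ⟩ := integral_eq_of_eqOn_Ioo_const hsb hd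
  rw [← intervalIntegral.integral_add_adjacent_intervals hi hj, hI, hJ]

/-- for the isolated material front with Y⁰_j = 1 for j ≤ 0 and
Y⁰_j = 0 for j ≥ 1, uniform ρ⁰ > 0, u⁰ > 0, p⁰ > 0 and 0 < λu⁰ ≤ 1/2, the
pressure in cell j = 1 (the cell [0, Δx)) after one full Lagrange step plus
conservative projection satisfies
p¹₁ = p⁰ (γ(Y¹₁) − 1)((1 − u⁰λ)/(γ₂ − 1) + u⁰λ/(γ₁ − 1)),
where Y¹₁ = (ρY)¹₁/ρ¹₁ = u⁰λ and p¹₁ = (γ(Y¹₁) − 1)((ρE)¹₁ − ρ⁰(u⁰)²/2). -/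
theorem conservative_projection_pressure_cell_one
    (Cp1 Cp2 Cv1 Cv2 : ℝ)
    (hCv1 : 0 < Cv1) (hCp1 : Cv1 < Cp1)
    (hCv2 : 0 < Cv2) (hCp2 : Cv2 < Cp2)
    (Δx Δt lam ρ0 u0 p0 : ℝ)
    (hΔx : 0 < Δx) (hΔt : 0 < Δt) (hlam : lam = Δt / Δx)
    (hρ0 : 0 < ρ0) (hu0 : 0 < u0) (hp0 : 0 < p0)
    (hcfl1 : 0 < lam * u0) (hcfl2 : lam * u0 ≤ 1 / 2)
    (Y0 : ℤ → ℝ) (hY0L : ∀ j ≤ 0, Y0 j = 1) (hY0R : ∀ j ≥ 1, Y0 j = 0)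
    (xstar : ℤ → ℝ) (hxstar : ∀ j, xstar j = (j : ℝ) * Δx + u0 * Δt)
    (ρfun ρYfun ρEfun : ℝ → ℝ)
    (hρfun : ∀ j : ℤ, ∀ x ∈ Set.Ioo (xstar (j - 1)) (xstar j), ρfun x = ρ0)
    (hρYfun : ∀ j : ℤ, ∀ x ∈ Set.Ioo (xstar (j - 1)) (xstar j),
      ρYfun x = ρ0 * Y0 j)
    (hρEfun : ∀ j : ℤ, ∀ x ∈ Set.Ioo (xstar (j - 1)) (xstar j),
      ρEfun x = p0 / (gam Cp1 Cp2 Cv1 Cv2 (Y0 j) - 1) + ρ0 * u0 ^ 2 / 2)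
    (Y1 : ℝ)
    (hY1 : Y1 = ((1 / Δx) * ∫ x in (0 : ℝ)..Δx, ρYfun x) /
        ((1 / Δx) * ∫ x in (0 : ℝ)..Δx, ρfun x)) :
    Y1 = u0 * lam ∧
    (gam Cp1 Cp2 Cv1 Cv2 Y1 - 1) *
        ((1 / Δx) * (∫ x in (0 : ℝ)..Δx, ρEfun x) - ρ0 * u0 ^ 2 / 2) =
      p0 * (gam Cp1 Cp2 Cv1 Cv2 Y1 - 1) *
        ((1 - u0 * lam) / (Cp2 / Cv2 - 1) + u0 * lam / (Cp1 / Cv1 - 1)) := by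
  have hΔt_eq : Δt = lam * Δx := by rw [hlam]; field_simp
  have hs0 : 0 ≤ u0 * Δt := by positivity
  have hsΔ : u0 * Δt ≤ Δx := by rw [hΔt_eq]; nlinarith
  have cell_avg : ∀ (f : ℝ → ℝ) (v : ℤ → ℝ),
      (∀ j : ℤ, ∀ x ∈ Set.Ioo (xstar (j - 1)) (xstar j), f x = v j) →
      (1 / Δx) * ∫ x in (0 : ℝ)..Δx, f x = u0 * lam * v 0 + (1 - u0 * lam) * v 1 := by
    intro f v hf
    have h0 : ∀ x ∈ Set.Ioo 0 (u0 * Δt), f x = v 0 := fun x hx => hf 0 x (by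
      rw [hxstar, hxstar]; push_cast
      constructor <;> linarith [hx.1, hx.2])
    have h1 : ∀ x ∈ Set.Ioo (u0 * Δt) Δx, f x = v 1 := fun x hx => hf 1 x (by
      rw [hxstar, hxstar]; push_cast
      constructor <;> linarith [hx.1, hx.2])
    rw [integral_eq_of_eqOn_Ioo_two_consts hs0 hsΔ h0 h1, hΔt_eq]
    field_simp
    ring
  have hY00 : Y0 0 = 1 := hY0L 0 le_rfl
  have hY01 : Y0 1 = 0 := hY0R 1 le_rfl
  constructor
  · rw [hY1, cell_avg ρfun (fun _ => ρ0) hρfun, cell_avg ρYfun (fun j => ρ0 * Y0 j) hρYfun,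
      hY00, hY01]
    field_simp
    ring
  · rw [cell_avg ρEfun _ hρEfun, hY00, hY01]
    have hγ1 : gam Cp1 Cp2 Cv1 Cv2 1 = Cp1 / Cv1 := by simp [gam]
    have hγ2 : gam Cp1 Cp2 Cv1 Cv2 0 = Cp2 / Cv2 := by simp [gam]
    rw [hγ1, hγ2]
    ring
end

section
/- The random-sampling projection of the mass fraction preserves a sharp front: suppose the velocity is uniform, u^n_{j+1/2} = u⁰ > 0 for all j with 0 < λu⁰ ≤ 1/2, so that x*_{j+1/2} = x_{j+1/2} + u⁰Δt, and suppose Y^{n+1−}_j = 1 for j ≤ k and Y^{n+1−}_j = 0 for j > k. Then for any a ∈ (0,1), the sampled values Y^{n+1}_j (defined by Y^{n+1}_j = Y^{n+1−}_{j−1} if x*_j ≤ x*_{j−1/2}, Y^{n+1}_j = Y^{n+1−}_j if x*_{j−1/2} ≤ x*_j ≤ x*_{j+1/2}, Y^{n+1}_j = Y^{n+1−}_{j+1} if x*_j ≥ x*_{j+1/2}, with x*_j = x_{j−1/2} + a Δx) again form a sharp front: there exists k' ∈ {k, k+1} with Y^{n+1}_j = 1 for j ≤ k' and Y^{n+1}_j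 = 0 for j > k'; in particular all Y^{n+1}_j ∈ {0,1} and no numerical diffusion of Y is created. -/
/-- The random-sampling projection of the mass fraction: with Eulerian
interfaces x_{j+1/2} = jΔx, moved interfaces x*_{j+1/2} = jΔx + u⁰Δt and
sampling point x*_j = x_{j−1/2} + aΔx = (j−1)Δx + aΔx, set
Y^{n+1}_j = Y^{n+1−}_{j−1} if x*_j ≤ x*_{j−1/2},
Y^{n+1}_j = Y^{n+1−}_{j+1} if x*_j ≥ x*_{j+1/2}, and
Y^{n+1}_j = Y^{n+1−}_j otherwise. -/
noncomputable def sampleY (Δx Δt u0 a : ℝ) (Y : ℤ → ℝ) (j : ℤ) : ℝ :=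
  if ((j : ℝ) - 1) * Δx + a * Δx ≤ ((j : ℝ) - 1) * Δx + u0 * Δt then Y (j - 1)
  else if (j : ℝ) * Δx + u0 * Δt ≤ ((j : ℝ) - 1) * Δx + a * Δx then Y (j + 1)
  else Y j

/-- A sampling point lying in the part of the cell swept by the left interface picks up the
left neighbour. -/
lemma sampleY_of_le {Δx Δt u0 a : ℝ} (h : a * Δx ≤ u0 * Δt) (Y : ℤ → ℝ) (j : ℤ) :
    sampleY Δx Δt u0 a Y j = Y (j - 1) :=
  if_pos (by linarith)

/-- When the flow goes to the right, a sampling point not swept by the left interface picks up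
the value of its own cell. -/
lemma sampleY_of_lt {Δx Δt u0 a : ℝ} (hΔx : 0 < Δx) (hu : 0 ≤ u0 * Δt) (ha : a < 1)
    (h : u0 * Δt < a * Δx) (Y : ℤ → ℝ) (j : ℤ) :
    sampleY Δx Δt u0 a Y j = Y j := by
  have haΔx : a * Δx < 1 * Δx := mul_lt_mul_of_pos_right ha hΔx
  rw [sampleY, if_neg (by linarith), if_neg (by linarith)]

/-- the random-sampling projection of the mass fraction
preserves a sharp front: with uniform velocity u⁰ > 0, 0 < λu⁰ ≤ 1/2, and
Y^{n+1−}_j = 1 for j ≤ k, Y^{n+1−}_j = 0 for j > k, the sampled values again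
form a sharp front at k' ∈ {k, k+1}; in particular every sampled value lies
in {0,1} and no numerical diffusion of Y is created. -/
theorem sampling_preserves_sharp_front
    (Δx Δt lam u0 a : ℝ)
    (hΔx : 0 < Δx) (hΔt : 0 < Δt) (hlam : lam = Δt / Δx)
    (hu0 : 0 < u0) (hcfl1 : 0 < lam * u0) (hcfl2 : lam * u0 ≤ 1 / 2)
    (ha : a ∈ Set.Ioo (0 : ℝ) 1)
    (Y : ℤ → ℝ) (k : ℤ)
    (hYL : ∀ j ≤ k, Y j = 1) (hYR : ∀ j > k, Y j = 0) :
    (∃ k' : ℤ, (k' = k ∨ k' = k + 1) ∧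
      (∀ j ≤ k', sampleY Δx Δt u0 a Y j = 1) ∧
      (∀ j > k', sampleY Δx Δt u0 a Y j = 0)) ∧
    ∀ j : ℤ, sampleY Δx Δt u0 a Y j ∈ ({0, 1} : Set ℝ) := by
  have front : ∃ k' : ℤ, (k' = k ∨ k' = k + 1) ∧
      (∀ j ≤ k', sampleY Δx Δt u0 a Y j = 1) ∧
      (∀ j > k', sampleY Δx Δt u0 a Y j = 0) := by
    rcases le_or_gt (a * Δx) (u0 * Δt) with h | h
    · refine ⟨k + 1, Or.inr rfl, fun j hj => ?_, fun j hj => ?_⟩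
      · rw [sampleY_of_le h, hYL _ (by omega)]
      · rw [sampleY_of_le h, hYR _ (by omega)]
    · have hs := sampleY_of_lt hΔx (mul_pos hu0 hΔt).le ha.2 h Y
      exact ⟨k, Or.inl rfl, fun j hj => (hs j).trans (hYL j hj),
        fun j hj => (hs j).trans (hYR j hj)⟩
  refine ⟨front, fun j => ?_⟩
  obtain ⟨k', -, hL, hR⟩ := front
  rcases le_or_gt j k' with hj | hj
  · exact Or.inr (hL j hj)
  · exact Or.inl (hR j hj)
end
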